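/- arXiv:1109.2823 — 2 statements merged into one kernel-verified Lean document; each statement's English description precedes it below -/
import Mathlib

section
/- Let X be a topological space and f : X → X a homeomorphism. Then f is topologically expansive if and only if f^k is topologically expansive for every nonzero integer k. -/
open Set Topology

namespace TopAnosovPaper

variable {X Y : Type*}

section Defs

variable [TopologicalSpace X]

/-- The `n`-th iterate (n ∈ ℤ) of a homeomorphism, as a function. -/
def iter (f : X ≃ₜ X) (n : ℤ) : X → X := ⇑(f.toEquiv ^ n)

/-- `N` is an expansive neighborhood for `f`: a closed neighborhood of the
diagonal such that any two distinct points are eventually separated by `F = f × f`. -/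
def IsExpansiveNbhd (f : X ≃ₜ X) (N : Set (X × X)) : Prop :=
  IsClosed N ∧ N ∈ nhdsSet (Set.diagonal X) ∧
    ∀ x y : X, x ≠ y → ∃ n : ℤ, (iter f n x, iter f n y) ∉ N

/-- `f` is topologically expansive. -/
def TopExpansive (f : X ≃ₜ X) : Prop := ∃ N : Set (X × X), IsExpansiveNbhd f N

/-- A `D`-pseudo-orbit: a bi-infinite sequence with `(f x_{i-1}, x_i) ∈ D`. -/
def IsPseudoOrbit (f : X ≃ₜ X) (D : Set (X × X)) (x : ℤ → X) : Prop :=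
  ∀ i : ℤ, (f (x (i - 1)), x i) ∈ D

/-- `y` `E`-traces the bi-infinite sequence `x`. -/
def Traces (f : X ≃ₜ X) (E : Set (X × X)) (y : X) (x : ℤ → X) : Prop :=
  ∀ i : ℤ, (iter f i y, x i) ∈ E

/-- `f` has the topological shadowing property. -/
def TopShadowing (f : X ≃ₜ X) : Prop :=
  ∀ E ∈ nhdsSet (Set.diagonal X), ∃ D ∈ nhdsSet (Set.diagonal X),
    ∀ x : ℤ → X, IsPseudoOrbit f D x → ∃ y : X, Traces f E y x

/-- `f` is topologically Anosov: expansive with the shadowing property. -/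
def TopAnosov (f : X ≃ₜ X) : Prop := TopExpansive f ∧ TopShadowing f

/-- An `A`-chain from `x` to `y` (of length `n ≥ 1`). -/
def IsChainFromTo (f : X ≃ₜ X) (A : Set (X × X)) (x y : X) : Prop :=
  ∃ n : ℕ, 1 ≤ n ∧ ∃ c : ℕ → X, c 0 = x ∧ c n = y ∧
    ∀ i : ℕ, 1 ≤ i → i ≤ n → (f (c (i - 1)), c i) ∈ A

/-- `x ∼ y`: for every neighborhood `A` of the diagonal there is an `A`-chain
from `x` to `y` and one from `y` to `x`. -/
def ChainRel (f : X ≃ₜ X) (x y : X) : Prop :=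
  ∀ A ∈ nhdsSet (Set.diagonal X), IsChainFromTo f A x y ∧ IsChainFromTo f A y x

/-- The chain recurrent set. -/
def CR (f : X ≃ₜ X) : Set X := {x | ChainRel f x x}

/-- `R` is a chain component: an equivalence class of `∼` restricted to `CR f`. -/
def IsChainComponent (f : X ≃ₜ X) (R : Set X) : Prop :=
  ∃ x ∈ CR f, R = {y | y ∈ CR f ∧ ChainRel f x y}

/-- The non-wandering set of `f`. -/
def NonWandering (f : X ≃ₜ X) : Set X :=
  {x | ∀ G : Set X, IsOpen G → x ∈ G → ∃ n : ℕ, 0 < n ∧ (iter f n '' G ∩ G).Nonempty}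

/-- `x` is a periodic point of `f`. -/
def Periodic (f : X ≃ₜ X) (x : X) : Prop := ∃ n : ℕ, 0 < n ∧ iter f n x = x

/-- The set of periodic points of `f`. -/
def Per (f : X ≃ₜ X) : Set X := {x | Periodic f x}

/-- A relation `M ⊆ X × X` is proper if `M[S]` is compact for every compact `S`. -/
def IsProperRel (M : Set (X × X)) : Prop :=
  ∀ S : Set X, IsCompact S → IsCompact {y : X | ∃ x ∈ S, (x, y) ∈ M}

/-- A set `U ⊆ X × X` is wide if `U ∪ (S × X) = X × X` for some compact `S`. -/
def IsWide (U : Set (X × X)) : Prop :=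
  ∃ S : Set X, IsCompact S ∧ U ∪ (S ×ˢ (Set.univ : Set X)) = Set.univ

/-- `E` is symmetric. -/
def SymmRel (E : Set (X × X)) : Prop := ∀ p : X × X, p ∈ E → (p.2, p.1) ∈ E

/-- `E² = {(x,y) : ∃ z, (x,z) ∈ E ∧ (z,y) ∈ E}`. -/
def sq (E : Set (X × X)) : Set (X × X) := {p : X × X | ∃ z : X, (p.1, z) ∈ E ∧ (z, p.2) ∈ E}

/-- The local stable set of `x` relative to `B`. -/
def WsLoc (f : X ≃ₜ X) (B : Set (X × X)) (x : X) : Set X :=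
  {y | ∀ i : ℤ, 0 ≤ i → (iter f i x, iter f i y) ∈ B}

/-- The local unstable set of `x` relative to `B`. -/
def WuLoc (f : X ≃ₜ X) (B : Set (X × X)) (x : X) : Set X :=
  {y | ∀ i : ℤ, i ≤ 0 → (iter f i x, iter f i y) ∈ B}

/-- The stable set of `x`. -/
def Ws (f : X ≃ₜ X) (x : X) : Set X :=
  {y | ∀ B ∈ nhdsSet (Set.diagonal X), ∃ n : ℕ, ∀ i : ℤ, (n : ℤ) ≤ i →
    (iter f i x, iter f i y) ∈ B}

/-- The unstable set of `x`. -/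
def Wu (f : X ≃ₜ X) (x : X) : Set X :=
  {y | ∀ B ∈ nhdsSet (Set.diagonal X), ∃ n : ℕ, ∀ i : ℤ, i ≤ -(n : ℤ) →
    (iter f i x, iter f i y) ∈ B}

/-- `f` restricted to `R` is topologically transitive: for any nonempty
relatively open subsets `G, H` of `R` there is `n ∈ ℕ` with `f^n(G) ∩ H ≠ ∅`. -/
def TransitiveOn (f : X ≃ₜ X) (R : Set X) : Prop :=
  ∀ G H : Set X, (∃ U : Set X, IsOpen U ∧ G = U ∩ R) → (∃ V : Set X, IsOpen V ∧ H = V ∩ R) →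
    G.Nonempty → H.Nonempty → ∃ n : ℕ, (iter f n '' G ∩ H).Nonempty

/-- `V_N(A)`: pairs whose first `N` forward and backward iterates all lie in `A`. -/
def VN (f : X ≃ₜ X) (A : Set (X × X)) (N : ℕ) : Set (X × X) :=
  {p : X × X | ∀ n : ℤ, |n| ≤ (N : ℤ) → (iter f n p.1, iter f n p.2) ∈ A}

/-- The `n`-th power (n ∈ ℕ) of a homeomorphism. -/
def hpowNat (f : X ≃ₜ X) : ℕ → X ≃ₜ X
  | 0 => Homeomorph.refl X
  | n + 1 => (hpowNat f n).trans f

/-- The `k`-th power (k ∈ ℤ) of a homeomorphism, as a homeomorphism. -/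
def hpow (f : X ≃ₜ X) : ℤ → X ≃ₜ X
  | Int.ofNat n => hpowNat f n
  | Int.negSucc n => (hpowNat f (n + 1)).symm

end Defs

end TopAnosovPaper

open TopAnosovPaper

namespace TopAnosovPaper

section Powers

variable {X : Type*} [TopologicalSpace X]

theorem toEquiv_hpowNat (f : X ≃ₜ X) (n : ℕ) : (hpowNat f n).toEquiv = f.toEquiv ^ n := by
  induction n with
  | zero => rfl
  | succ n ih =>
    rw [pow_succ', ← ih]
    rfl

theorem toEquiv_hpow (f : X ≃ₜ X) (k : ℤ) : (hpow f k).toEquiv = f.toEquiv ^ k := by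
  cases k with
  | ofNat n => exact (toEquiv_hpowNat f n).trans (zpow_natCast _ n).symm
  | negSucc n =>
    rw [zpow_negSucc, ← toEquiv_hpowNat]
    rfl

theorem hpow_one (f : X ≃ₜ X) : hpow f 1 = f :=
  Homeomorph.toEquiv_injective ((toEquiv_hpow f 1).trans (zpow_one _))

theorem continuous_iter (f : X ≃ₜ X) (n : ℤ) : Continuous (iter f n) := by
  have h : iter f n = hpow f n := by
    rw [iter, ← toEquiv_hpow]
    rfl
  exact h ▸ (hpow f n).continuous

theorem iter_hpow (f : X ≃ₜ X) (k n : ℤ) : iter (hpow f k) n = iter f (k * n) := by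
  rw [iter, iter, toEquiv_hpow, zpow_mul]

theorem iter_add (f : X ≃ₜ X) (m n : ℤ) (x : X) : iter f (m + n) x = iter f m (iter f n x) := by
  rw [iter, zpow_add]
  rfl

/-- If `N` is an expansive neighborhood for `f`, the pairs whose iterates of order
`0, …, |k| - 1` stay in `N` form an expansive neighborhood for `f ^ k`. -/
theorem IsExpansiveNbhd.zpow {f : X ≃ₜ X} {N : Set (X × X)} (hN : IsExpansiveNbhd f N)
    {k : ℤ} (hk : k ≠ 0) :
    IsExpansiveNbhd (hpow f k)
      (⋂ r ∈ Finset.range k.natAbs, Prod.map (iter f r) (iter f r) ⁻¹' N) := by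
  obtain ⟨hclosed, hnhds, hsep⟩ := hN
  have hcont (n : ℤ) : Continuous (Prod.map (iter f n) (iter f n)) :=
    (continuous_iter f n).prodMap (continuous_iter f n)
  refine ⟨isClosed_biInter fun r _ => hclosed.preimage (hcont r), ?_, fun x y hxy => ?_⟩
  · refine (Filter.biInter_finset_mem _).2 fun r _ => (hcont r).tendsto_nhdsSet ?_ hnhds
    rintro ⟨x, y⟩ (rfl : x = y)
    exact rfl
  · obtain ⟨n, hn⟩ := hsep x y hxy
    refine ⟨n / k, fun hmem => hn ?_⟩
    have hnonneg := Int.emod_nonneg n hk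
    have hlt := Int.emod_lt n hk
    have hr := Set.mem_iInter₂.1 hmem (n % k).toNat (Finset.mem_range.2 (by lia))
    simpa only [Set.mem_preimage, Prod.map_apply, iter_hpow, ← iter_add,
      Int.toNat_of_nonneg hnonneg, Int.emod_add_mul_ediv] using hr

end Powers

end TopAnosovPaper

/-- `f` is topologically expansive iff `f^k` is, for every nonzero `k ∈ ℤ`. -/
theorem topExpansive_iff_zpow {X : Type*} [TopologicalSpace X] (f : X ≃ₜ X) :
    TopExpansive f ↔ ∀ k : ℤ, k ≠ 0 → TopExpansive (hpow f k) := by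
  refine ⟨fun ⟨_, hN⟩ _ hk => ⟨_, hN.zpow hk⟩, fun h => ?_⟩
  simpa only [hpow_one] using h 1 one_ne_zero
end

section
/- Let X be a topological space, f, g : X → X homeomorphisms, and B a symmetric subset of X × X such that B² is an expansive neighborhood for g. If h : X → X is a map satisfying (h(x), x) ∈ B for all x ∈ X and f ∘ h = h ∘ g, then h is injective. -/
open Set Topology

open TopAnosovPaper

/-- A semiconjugacy between homeomorphisms intertwines all their integer iterates. -/
theorem semiconj_iter {X : Type*} [TopologicalSpace X] {f g : X ≃ₜ X} {h : X → X}
    (hc : ∀ x : X, f (h x) = h (g x)) (n : ℤ) (x : X) : iter f n (h x) = h (iter g n x) := by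
  have hinv : ∀ y : X, f.toEquiv⁻¹ (h y) = h (g.toEquiv⁻¹ y) := fun y ↦ by
    rw [Equiv.Perm.inv_eq_iff_eq]
    exact ((hc _).trans (congrArg h (g.apply_symm_apply y))).symm
  unfold iter
  induction n generalizing x with
  | zero => simp
  | succ n ih =>
    rw [zpow_add_one, zpow_add_one, Equiv.Perm.mul_apply, Equiv.Perm.mul_apply, ← ih]
    exact congrArg _ (hc x)
  | pred n ih =>
    rw [zpow_sub_one, zpow_sub_one, Equiv.Perm.mul_apply, Equiv.Perm.mul_apply, ← ih, hinv]

/-- Injectivity of the semiconjugacy when `B` is symmetric and `B²` is an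
expansive neighborhood for `g`. -/
theorem semiconj_injective {X : Type*} [TopologicalSpace X] (f g : X ≃ₜ X)
    (B : Set (X × X)) (hBsymm : SymmRel B) (hB2 : IsExpansiveNbhd g (sq B))
    (h : X → X) (hh : ∀ x : X, (h x, x) ∈ B)
    (hc : ∀ x : X, f (h x) = h (g x)) :
    Function.Injective h := by
  intro x y hxy
  by_contra hne
  obtain ⟨n, hn⟩ := hB2.2.2 x y hne
  refine hn ⟨h (iter g n x), hBsymm _ (hh _), ?_⟩
  rw [← semiconj_iter hc, hxy, semiconj_iter hc]
  exact hh _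
end
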